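/- arXiv:1901.07057 — 2 statements merged into one kernel-verified Lean document; each statement's English description precedes it below -/
import Mathlib

section
/- Let q ≥ 2 and m ≥ 1 be integers and K = mq. Then the equal-grouping PTB subpacketization for t̄ = K − t = 2 satisfies F(q) := (q−2)·m·C(q, 2) + (q−1)·C(m, 2)·q² = K(K−2)(q−1)/2. Consequently, for fixed K, among all equal groupings into groups of size q ≥ 2, F(q) is minimized at q = 2, where F(2) = K(K−2)/2, i.e., F(q) ≥ K(K−2)/2 with equality exactly when q = 2. -/
/-- Equal-grouping PTB design for `K = mq` users in `m` groups of size `q ≥ 2`, with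
`t̄ = K − t = 2`: the subpacketization
`F(q) = (q−2)·m·C(q, 2) + (q−1)·C(m, 2)·q²` equals `K(K−2)(q−1)/2`.  Consequently, for
fixed `K`, among all equal groupings into groups of size `q ≥ 2`, `F(q)` is minimized at
`q = 2`: `F(q) ≥ K(K−2)/2`, with equality exactly when `q = 2`. -/
theorem stmt12 (q m : ℕ) (hq : 2 ≤ q) (hm : 1 ≤ m) :
    let K : ℕ := m * q
    let F : ℕ := (q - 2) * m * Nat.choose q 2 + (q - 1) * Nat.choose m 2 * q ^ 2
    (F : ℝ) = (K : ℝ) * ((K : ℝ) - 2) * ((q : ℝ) - 1) / 2 ∧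
      (K : ℝ) * ((K : ℝ) - 2) / 2 ≤ (F : ℝ) ∧
      ((F : ℝ) = (K : ℝ) * ((K : ℝ) - 2) / 2 ↔ q = 2) := by
  intro K F
  have hq' : (2 : ℝ) ≤ q := by exact_mod_cast hq
  have hm' : (1 : ℝ) ≤ m := by exact_mod_cast hm
  have hK : (K : ℝ) = m * q := by simp [K]
  have hqK : (q : ℝ) ≤ K := by rw [hK]; nlinarith
  have hF : (F : ℝ) = (K : ℝ) * ((K : ℝ) - 2) * ((q : ℝ) - 1) / 2 := by
    simp only [F, hK]
    push_cast [Nat.cast_sub hq, Nat.cast_sub (one_le_two.trans hq), Nat.cast_choose_two]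
    ring
  have hKK : 0 ≤ (K : ℝ) * ((K : ℝ) - 2) :=
    mul_nonneg (by linarith) (by linarith)
  refine ⟨hF, ?_, fun h => ?_, fun h => ?_⟩
  · rw [hF]
    nlinarith
  · by_contra hne
    have hlt : (2 : ℝ) < q := by exact_mod_cast lt_of_le_of_ne hq (Ne.symm hne)
    have hpos : 0 < (K : ℝ) * ((K : ℝ) - 2) := mul_pos (by linarith) (by linarith)
    rw [hF] at h
    nlinarith [mul_pos hpos (sub_pos.mpr hlt)]
  · rw [hF, h]
    push_cast
    ring
end

section
/- Let q ≥ 5 be an integer and K = 2q. The two-group equal-grouping PTB subpacketization for t = 4 equals F^PTB = 1·2·C(q,1)·C(q,3) + 2·C(q,2)² = K²(K−2)(5K−14)/96, and F^PTB / (4·C(K, 4)) = K(5K−14)/(16(K−1)(K−3)), which is at most 5/14 for all even K ≥ 10. -/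
/-- Two-group equal-grouping PTB scheme for `K = 2q` (`q ≥ 5`) and `t = 4` (`r = 2`), with
raw packet counts `G₁ = 2·C(q,0)·C(q,4)`, `G₂ = 2·C(q,1)·C(q,3)`, `G₃ = C(q,2)²` and
splitting ratio vector `(0, 1, 2)`: the subpacketization
`F^PTB = 1·2·C(q,1)·C(q,3) + 2·C(q,2)²` equals `K²(K−2)(5K−14)/96`, and
`F^PTB / (4·C(K, 4)) = K(5K−14)/(16(K−1)(K−3))`, which is at most `5/14` for all even
`K ≥ 10`. -/
theorem stmt16 (q : ℕ) (hq : 5 ≤ q) :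
    let K : ℕ := 2 * q
    let F : ℕ := 0 * (2 * Nat.choose q 0 * Nat.choose q 4) +
        1 * (2 * Nat.choose q 1 * Nat.choose q 3) + 2 * Nat.choose q 2 ^ 2
    F = K ^ 2 * (K - 2) * (5 * K - 14) / 96 ∧
      (F : ℝ) / ((4 * Nat.choose K 4 : ℕ) : ℝ)
        = (K : ℝ) * (5 * (K : ℝ) - 14) / (16 * ((K : ℝ) - 1) * ((K : ℝ) - 3)) ∧
      (K : ℝ) * (5 * (K : ℝ) - 14) / (16 * ((K : ℝ) - 1) * ((K : ℝ) - 3)) ≤ 5 / 14 := by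
  obtain ⟨n, rfl⟩ := Nat.exists_eq_add_of_le hq
  intro K F
  have h2 : (n + 5) * (n + 4) = 2 * Nat.choose (5 + n) 2 := by
    simpa [Nat.descFactorial, Nat.factorial, add_comm, mul_comm] using
      Nat.descFactorial_eq_factorial_mul_choose (n + 5) 2
  have h3 : (n + 5) * (n + 4) * (n + 3) = 6 * Nat.choose (5 + n) 3 := by
    have h := Nat.descFactorial_eq_factorial_mul_choose (n + 5) 3
    simp only [Nat.descFactorial, Nat.factorial,
      Nat.reduceSubDiff, Nat.sub_zero] at h
    rw [add_comm n 5] at h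
    linarith
  have h4 : (2 * n + 10) * (2 * n + 9) * (2 * n + 8) * (2 * n + 7) = 24 * Nat.choose K 4 := by
    have h := Nat.descFactorial_eq_factorial_mul_choose (2 * n + 10) 4
    simp only [Nat.descFactorial, Nat.factorial,
      Nat.reduceSubDiff, Nat.sub_zero] at h
    rw [show K = 2 * n + 10 by simp only [K]; ring]
    linarith
  have hF : 6 * F = (n + 5) ^ 2 * (n + 4) * (5 * n + 18) := by
    simp only [F, Nat.choose_one_right]
    calc _ = 2 * (5 + n) * (6 * Nat.choose (5 + n) 3) + 3 * (2 * Nat.choose (5 + n) 2) ^ 2 := by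
          ring
      _ = _ := by rw [← h2, ← h3]; ring
  have hK : (K : ℝ) = 2 * n + 10 := by simp only [K]; push_cast; ring
  have hn : (0 : ℝ) ≤ n := n.cast_nonneg
  refine ⟨?_, ?_, ?_⟩
  · have e1 : K - 2 = 2 * (n + 4) := by omega
    have e2 : 5 * K - 14 = 2 * (5 * n + 18) := by omega
    rw [e1, e2]
    refine (Nat.div_eq_of_eq_mul_left (by norm_num) ?_).symm
    calc _ = 16 * ((n + 5) ^ 2 * (n + 4) * (5 * n + 18)) := by simp only [K]; ring
      _ = _ := by rw [← hF]; ring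
  · have hFr : (F : ℝ) = (n + 5) ^ 2 * (n + 4) * (5 * n + 18) / 6 := by
      rw [eq_div_iff (by norm_num), mul_comm]
      exact_mod_cast hF
    have hCr : ((4 * Nat.choose K 4 : ℕ) : ℝ)
        = (2 * n + 10) * (2 * n + 9) * (2 * n + 8) * (2 * n + 7) / 6 := by
      have h : ((2 * n + 10) * (2 * n + 9) * (2 * n + 8) * (2 * n + 7) : ℝ)
          = 24 * (Nat.choose K 4 : ℝ) := by exact_mod_cast h4
      push_cast
      linarith
    rw [hFr, hCr, hK, show (2 * n + 10 - 1 : ℝ) = 2 * n + 9 by ring,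
      show (2 * n + 10 - 3 : ℝ) = 2 * n + 7 by ring]
    rw [div_eq_div_iff (by positivity) (by positivity)]
    ring
  · rw [hK, show (2 * n + 10 - 1 : ℝ) = 2 * n + 9 by ring,
      show (2 * n + 10 - 3 : ℝ) = 2 * n + 7 by ring,
      div_le_div_iff₀ (by positivity) (by norm_num)]
    nlinarith
end
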